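/- arXiv:1910.13139 — 3 statements merged into one kernel-verified Lean document; each statement's English description precedes it below -/
import Mathlib

section
/- Fix n ≥ 1 and a positive integer D. There are only finitely many classes of symmetric positive definite n×n integer matrices of determinant D up to integral congruence: there exists a finite set S of symmetric positive definite integer matrices of determinant D such that every symmetric positive definite n×n integer matrix A with det A = D satisfies Pᵀ A P ∈ S for some P ∈ GL_n(ℤ). -/
open Matrix

namespace Matrix

/-- The Schur complement of the top left entry, scaled by that entry to clear denominators. -/
def scaledSchur {m : ℕ} (A : Matrix (Fin (m + 1)) (Fin (m + 1)) ℤ) : Matrix (Fin m) (Fin m) ℤ :=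
  of fun i j => A 0 0 * A i.succ j.succ - A 0 i.succ * A 0 j.succ

/-- The block upper triangular matrix with diagonal blocks `1`, `Q` and top right block `s`. -/
def unipotentExtension {m : ℕ} (s : Fin m → ℤ) (Q : Matrix (Fin m) (Fin m) ℤ) :
    Matrix (Fin (m + 1)) (Fin (m + 1)) ℤ :=
  of (Fin.cons (Fin.cons 1 s) fun i => Fin.cons 0 (Q i))

theorem det_unipotentExtension {m : ℕ} (s : Fin m → ℤ) (Q : Matrix (Fin m) (Fin m) ℤ) :
    (unipotentExtension s Q).det = Q.det := by
  rw [det_succ_column_zero, Fin.sum_univ_succ]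
  simp only [unipotentExtension, of_apply, Fin.cons_zero, Fin.cons_succ]
  simp only [Fin.val_zero, pow_zero, mul_one, one_mul, mul_zero, zero_mul, Finset.sum_const_zero,
    add_zero]
  congr 1

theorem IsSymm.congruence {ι : Type*} [Fintype ι] {A : Matrix ι ι ℤ} (hA : A.IsSymm)
    (P : Matrix ι ι ℤ) : (Pᵀ * A * P).IsSymm := by
  rw [IsSymm, transpose_mul, transpose_mul, transpose_transpose, hA.eq, Matrix.mul_assoc]

theorem det_congruence {ι : Type*} [Fintype ι] [DecidableEq ι] (A : Matrix ι ι ℤ)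
    {P : Matrix ι ι ℤ} (hP : IsUnit P.det) : (Pᵀ * A * P).det = A.det := by
  have h : P.det * P.det = 1 := Int.isUnit_mul_self hP
  rw [det_mul, det_mul, det_transpose, mul_right_comm, h, one_mul]

theorem PosDef.congruence_of_isUnit_det {ι : Type*} [Fintype ι] [DecidableEq ι] {A : Matrix ι ι ℤ}
    (hA : A.PosDef) {P : Matrix ι ι ℤ} (hP : IsUnit P.det) : (Pᵀ * A * P).PosDef := by
  have := hA.conjTranspose_mul_mul_same (B := P)
    (mulVec_injective_of_isUnit ((isUnit_iff_isUnit_det P).2 hP))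
  rwa [conjTranspose_eq_transpose_of_trivial] at this

theorem PosDef.isSymm_of_int {ι : Type*} {A : Matrix ι ι ℤ} (hA : A.PosDef) : A.IsSymm := by
  rw [IsSymm, ← conjTranspose_eq_transpose_of_trivial]
  exact hA.isHermitian

theorem isSymm_scaledSchur {m : ℕ} {A : Matrix (Fin (m + 1)) (Fin (m + 1)) ℤ} (hA : A.IsSymm) :
    A.scaledSchur.IsSymm := by
  ext i j
  simp only [scaledSchur, transpose_apply, of_apply, hA.apply i.succ j.succ]
  ring

theorem mul_det_scaledSchur {m : ℕ} {A : Matrix (Fin (m + 1)) (Fin (m + 1)) ℤ} (hA : A.IsSymm) :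
    A 0 0 * A.scaledSchur.det = A 0 0 ^ m * A.det := by
  let E : Matrix (Fin (m + 1)) (Fin (m + 1)) ℤ :=
    of (Fin.cons (Fin.cons 1 0) fun i => Fin.cons (-A 0 i.succ) (A 0 0 • (1 : Matrix _ _ ℤ) i))
  have hE : E.det = A 0 0 ^ m := by
    rw [det_succ_row_zero, Fin.sum_univ_succ]
    have : E.submatrix Fin.succ (Fin.succAbove 0) = A 0 0 • (1 : Matrix (Fin m) (Fin m) ℤ) := by
      ext i j; simp [E]
    rw [this, det_smul]
    simp [E]
  rw [← hE, ← det_mul, det_succ_column_zero, Fin.sum_univ_succ]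
  have h0 : (E * A) 0 0 = A 0 0 := by
    simp [E, mul_apply, Fin.sum_univ_succ]
  have hs (i : Fin m) (j : Fin (m + 1)) :
      (E * A) i.succ j = A 0 0 * A i.succ j - A 0 i.succ * A 0 j := by
    simp [E, mul_apply, Fin.sum_univ_succ, one_apply]
    ring
  have hs0 (i : Fin m) : (E * A) i.succ 0 = 0 := by
    rw [hs, hA.apply 0 i.succ]; ring
  have : (E * A).submatrix (Fin.succAbove 0) Fin.succ = A.scaledSchur := by
    ext i j; simp [hs, scaledSchur]
  rw [this]
  simp [h0, hs0]

theorem PosDef.scaledSchur {m : ℕ} {A : Matrix (Fin (m + 1)) (Fin (m + 1)) ℤ} (hA : A.PosDef) :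
    A.scaledSchur.PosDef := by
  have hs : A.IsSymm := hA.isSymm_of_int
  have ha : 0 < A 0 0 := hA.diag_pos
  refine PosDef.of_dotProduct_mulVec_pos ?_ fun x hx => ?_
  · rw [IsHermitian, conjTranspose_eq_transpose_of_trivial]
    exact isSymm_scaledSchur hs
  let y : Fin (m + 1) → ℤ := Fin.cons (-∑ i, A 0 i.succ * x i) (A 0 0 • x)
  have hy : y ≠ 0 := by
    intro h
    apply hx
    ext i
    have := congrFun h i.succ
    simpa [y, ha.ne'] using this
  have key : star y ⬝ᵥ (A *ᵥ y) = A 0 0 * (star x ⬝ᵥ (A.scaledSchur *ᵥ x)) := by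
    have hl : ∑ i, x i * A i.succ 0 = ∑ i, A 0 i.succ * x i :=
      Finset.sum_congr rfl fun i _ => by rw [hs.apply, mul_comm]
    have h1 : star x ⬝ᵥ (A.scaledSchur *ᵥ x) =
        A 0 0 * (∑ i, x i * ∑ j, A i.succ j.succ * x j) - (∑ i, A 0 i.succ * x i) ^ 2 := by
      simp only [dotProduct, mulVec, Matrix.scaledSchur, of_apply, star_trivial, sub_mul,
        Finset.sum_sub_distrib, mul_sub, sq, Finset.sum_mul, Finset.mul_sum]
      congr 1 <;> refine Finset.sum_congr rfl fun i _ => Finset.sum_congr rfl fun j _ => by ring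
    rw [h1]
    have h2 : star y ⬝ᵥ (A *ᵥ y) = -(∑ i, A 0 i.succ * x i) *
          (A 0 0 * -(∑ i, A 0 i.succ * x i) + A 0 0 * ∑ i, A 0 i.succ * x i) +
        (A 0 0 * -(∑ i, A 0 i.succ * x i) * (∑ i, x i * A i.succ 0) +
          A 0 0 ^ 2 * ∑ i, x i * ∑ j, A i.succ j.succ * x j) := by
      simp only [dotProduct, mulVec, star_trivial, Fin.sum_univ_succ, y, Fin.cons_zero,
        Fin.cons_succ, Pi.smul_apply, smul_eq_mul]
      congr 1
      · congr 2
        rw [Finset.mul_sum]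
        exact Finset.sum_congr rfl fun i _ => by ring
      · simp only [mul_add, Finset.sum_add_distrib]
        congr 1
        · rw [Finset.mul_sum]
          exact Finset.sum_congr rfl fun i _ => by ring
        · simp only [Finset.mul_sum]
          exact Finset.sum_congr rfl fun i _ => Finset.sum_congr rfl fun j _ => by ring
    rw [h2, hl]
    ring
  have := hA.dotProduct_mulVec_pos hy
  rw [key] at this
  exact pos_of_mul_pos_right this ha.le

theorem congruence_unipotentExtension_zero_zero {m : ℕ}
    (A : Matrix (Fin (m + 1)) (Fin (m + 1)) ℤ) (s : Fin m → ℤ) (Q : Matrix (Fin m) (Fin m) ℤ) :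
    ((unipotentExtension s Q)ᵀ * A * unipotentExtension s Q) 0 0 = A 0 0 := by
  simp [unipotentExtension, mul_apply, Fin.sum_univ_succ]

theorem congruence_unipotentExtension_zero_succ {m : ℕ}
    (A : Matrix (Fin (m + 1)) (Fin (m + 1)) ℤ) (s : Fin m → ℤ) (Q : Matrix (Fin m) (Fin m) ℤ)
    (j : Fin m) :
    ((unipotentExtension s Q)ᵀ * A * unipotentExtension s Q) 0 j.succ =
      A 0 0 * s j + ∑ k, A 0 k.succ * Q k j := by
  simp [unipotentExtension, mul_apply, Fin.sum_univ_succ]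

theorem scaledSchur_congruence_unipotentExtension {m : ℕ}
    {A : Matrix (Fin (m + 1)) (Fin (m + 1)) ℤ} (hA : A.IsSymm)
    (s : Fin m → ℤ) (Q : Matrix (Fin m) (Fin m) ℤ) :
    ((unipotentExtension s Q)ᵀ * A * unipotentExtension s Q).scaledSchur =
      Qᵀ * A.scaledSchur * Q := by
  ext i j
  have h1 : ((unipotentExtension s Q)ᵀ * A * unipotentExtension s Q) i.succ j.succ =
      A 0 0 * s i * s j + s i * (∑ k, A 0 k.succ * Q k j) + s j * (∑ k, A 0 k.succ * Q k i) +
        ∑ l, (∑ k, Q k i * A k.succ l.succ) * Q l j := by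
    have hl : ∑ k, Q k i * A k.succ 0 = ∑ k, A 0 k.succ * Q k i :=
      Finset.sum_congr rfl fun k _ => by rw [hA.apply, mul_comm]
    simp only [unipotentExtension, mul_apply, Fin.sum_univ_succ, transpose_apply, of_apply,
      Fin.cons_zero, Fin.cons_succ, hl, add_mul, Finset.sum_add_distrib]
    have h3 : ∑ x, s i * A 0 x.succ * Q x j = s i * ∑ x, A 0 x.succ * Q x j := by
      simp only [Finset.mul_sum, mul_assoc]
    rw [h3]
    ring
  have h2 : (Qᵀ * A.scaledSchur * Q) i j =
      A 0 0 * (∑ l, (∑ k, Q k i * A k.succ l.succ) * Q l j) -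
        (∑ k, A 0 k.succ * Q k i) * (∑ k, A 0 k.succ * Q k j) := by
    simp only [mul_apply, transpose_apply, scaledSchur, of_apply, mul_sub, sub_mul,
      Finset.sum_sub_distrib, Finset.mul_sum, Finset.sum_mul]
    congr 1 <;> refine Finset.sum_congr rfl fun i _ => Finset.sum_congr rfl fun j _ => by ring
  rw [h2]
  simp only [scaledSchur, of_apply, congruence_unipotentExtension_zero_zero,
    congruence_unipotentExtension_zero_succ]
  rw [h1]
  ring

/-- Transposing two coordinates moves any diagonal entry to the top left corner. -/
theorem exists_congruence_zero_zero_eq_diag {m : ℕ} (A : Matrix (Fin (m + 1)) (Fin (m + 1)) ℤ)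
    (i : Fin (m + 1)) :
    ∃ P : Matrix (Fin (m + 1)) (Fin (m + 1)) ℤ, IsUnit P.det ∧ (Pᵀ * A * P) 0 0 = A i i := by
  refine ⟨(1 : Matrix _ _ ℤ).submatrix id (Equiv.swap 0 i), ?_, ?_⟩
  · rw [det_permute', det_one, mul_one]
    exact Units.isUnit _
  · simp [mul_apply, one_apply]

/-- A congruence making the top left entry minimal among all congruent matrices. -/
theorem PosDef.exists_congruence_minimal {m : ℕ} {A : Matrix (Fin (m + 1)) (Fin (m + 1)) ℤ}
    (hA : A.PosDef) :
    ∃ P : Matrix (Fin (m + 1)) (Fin (m + 1)) ℤ, IsUnit P.det ∧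
      ∀ Q : Matrix (Fin (m + 1)) (Fin (m + 1)) ℤ, IsUnit Q.det →
        (Pᵀ * A * P) 0 0 ≤ (Qᵀ * A * Q) 0 0 := by
  obtain ⟨P, hP, hmin⟩ := exists_minimalFor_of_wellFoundedLT
    (fun P : Matrix (Fin (m + 1)) (Fin (m + 1)) ℤ => IsUnit P.det)
    (fun P => ((Pᵀ * A * P) 0 0).toNat) ⟨1, by simp⟩
  refine ⟨P, hP, fun Q hQ => ?_⟩
  have h1 : 0 < (Pᵀ * A * P) 0 0 := (hA.congruence_of_isUnit_det hP).diag_pos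
  have h2 : 0 < (Qᵀ * A * Q) 0 0 := (hA.congruence_of_isUnit_det hQ).diag_pos
  have h3 := hmin hQ
  simp only at h3
  omega

end Matrix

theorem Int.exists_two_mul_abs_mul_add_le {a : ℤ} (ha : 0 < a) (b : ℤ) :
    ∃ s : ℤ, 2 * |a * s + b| ≤ a := by
  refine ⟨-((2 * b + a) / (2 * a)), ?_⟩
  have h1 := Int.emod_add_mul_ediv (2 * b + a) (2 * a)
  have h2 := Int.emod_nonneg (2 * b + a) (by omega : 2 * a ≠ 0)
  have h3 := Int.emod_lt_of_pos (2 * b + a) (by omega : 0 < 2 * a)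
  rcases abs_cases (a * -((2 * b + a) / (2 * a)) + b) with ⟨h, -⟩ | ⟨h, -⟩ <;>
    rw [h] <;> nlinarith

/-- Hermite reduction: every positive definite integral form is integrally congruent to one
whose leading coefficient satisfies Hermite's bound and whose coefficients are bounded in terms
of the determinant. -/
theorem Matrix.PosDef.exists_hermite_reduced (n : ℕ) :
    ∃ K : ℤ, 0 < K ∧ ∃ M : ℤ → ℤ, ∀ A : Matrix (Fin (n + 1)) (Fin (n + 1)) ℤ,
      A.PosDef → 0 < A.det →
        ∃ P : Matrix (Fin (n + 1)) (Fin (n + 1)) ℤ, IsUnit P.det ∧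
          (Pᵀ * A * P) 0 0 ^ (n + 1) ≤ K * A.det ∧
          ∀ i j, |(Pᵀ * A * P) i j| ≤ M A.det := by
  induction n with
  | zero =>
    refine ⟨1, one_pos, id, fun A _ hdet => ⟨1, by simp, by simp, fun i j => ?_⟩⟩
    obtain rfl : i = 0 := Fin.fin_one_eq_zero i
    obtain rfl : j = 0 := Fin.fin_one_eq_zero j
    rw [det_fin_one A] at hdet ⊢
    simpa using (abs_of_pos hdet).le
  | succ n ih =>
    obtain ⟨K, hK, M, hM⟩ := ih
    refine ⟨4 ^ (n + 1) * K, by positivity, fun D =>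
      ∑ a ∈ Finset.Icc 1 (4 ^ (n + 1) * K * D), |M (a ^ n * D)| + (4 ^ (n + 1) * K * D) ^ 2,
      fun A₀ hA₀ hdet₀ => ?_⟩
    obtain ⟨P₀, hP₀, hmin⟩ := hA₀.exists_congruence_minimal
    set A := P₀ᵀ * A₀ * P₀ with hAdef
    have hA : A.PosDef := hA₀.congruence_of_isUnit_det hP₀
    have hdet : A.det = A₀.det := det_congruence A₀ hP₀
    have hs : A.IsSymm := hA.isSymm_of_int
    have ha : 0 < A 0 0 := hA.diag_pos
    have hSdet : A.scaledSchur.det = A 0 0 ^ n * A₀.det := by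
      have h := mul_det_scaledSchur hs
      rw [pow_succ', mul_assoc, hdet] at h
      exact mul_left_cancel₀ ha.ne' h
    obtain ⟨Q, hQ, hQK, hQM⟩ := hM A.scaledSchur hA.scaledSchur (by rw [hSdet]; positivity)
    choose s hsb using fun j : Fin (n + 1) =>
      Int.exists_two_mul_abs_mul_add_le ha (∑ k, A 0 k.succ * Q k j)
    set U := unipotentExtension s Q with hU
    have hUdet : IsUnit U.det := by rwa [hU, det_unipotentExtension]
    set B := Uᵀ * A * U with hB
    have hBPU (R : Matrix (Fin (n + 2)) (Fin (n + 2)) ℤ) :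
        (P₀ * U * R)ᵀ * A₀ * (P₀ * U * R) = Rᵀ * B * R := by
      simp only [hB, hAdef, transpose_mul, Matrix.mul_assoc]
    have hB' : (P₀ * U)ᵀ * A₀ * (P₀ * U) = B := by
      simpa using hBPU 1
    have hBs : B.IsSymm := hs.congruence U
    have hB00 : B 0 0 = A 0 0 := congruence_unipotentExtension_zero_zero A s Q
    have hB0 (j : Fin (n + 1)) : 2 * |B 0 j.succ| ≤ A 0 0 := by
      rw [hB, hU, congruence_unipotentExtension_zero_succ]
      exact hsb j
    have hBS (i j : Fin (n + 1)) : A 0 0 * B i.succ j.succ =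
        (Qᵀ * A.scaledSchur * Q) i j + B 0 i.succ * B 0 j.succ := by
      have h : B 0 0 * B i.succ j.succ - B 0 i.succ * B 0 j.succ =
          (Qᵀ * A.scaledSchur * Q) i j :=
        congrFun (congrFun (scaledSchur_congruence_unipotentExtension hs s Q) i) j
      rw [hB00] at h
      linarith
    have hB11 : A 0 0 ≤ B 1 1 := by
      obtain ⟨R, hR, hR1⟩ := exists_congruence_zero_zero_eq_diag B 1
      rw [← hR1, ← hBPU]
      refine hmin _ ?_
      rw [det_mul, det_mul]
      exact (hP₀.mul hUdet).mul hR
    set c := (Qᵀ * A.scaledSchur * Q) 0 0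
    have hc4 : A 0 0 ^ 2 ≤ 4 * c := by
      have h1 := hBS 0 0
      have h2 := hB0 0
      rw [Fin.succ_zero_eq_one] at h1 h2
      have h3 := abs_nonneg (B 0 1)
      have h4 := sq_abs (B 0 1)
      nlinarith
    have hbound : A 0 0 ^ (n + 2) ≤ 4 ^ (n + 1) * K * A₀.det := by
      rw [hSdet] at hQK
      have h1 : (A 0 0 ^ 2) ^ (n + 1) ≤ (4 * c) ^ (n + 1) := by gcongr
      have h2 : A 0 0 ^ n * A 0 0 ^ (n + 2) ≤ A 0 0 ^ n * (4 ^ (n + 1) * K * A₀.det) := by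
        calc A 0 0 ^ n * A 0 0 ^ (n + 2) = (A 0 0 ^ 2) ^ (n + 1) := by ring
          _ ≤ (4 * c) ^ (n + 1) := h1
          _ = 4 ^ (n + 1) * c ^ (n + 1) := mul_pow _ _ _
          _ ≤ 4 ^ (n + 1) * (K * (A 0 0 ^ n * A₀.det)) := by gcongr
          _ = _ := by ring
      exact le_of_mul_le_mul_left h2 (by positivity)
    set L := 4 ^ (n + 1) * K * A₀.det
    have haL : A 0 0 ≤ L := (le_self_pow₀ ha (by omega)).trans hbound
    have hLL : A 0 0 ≤ L ^ 2 := by nlinarith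
    refine ⟨P₀ * U, by rw [det_mul]; exact hP₀.mul hUdet, ?_, ?_⟩
    · rw [hB', hB00]
      exact hbound
    · rw [hB']
      set T := ∑ a ∈ Finset.Icc 1 L, |M (a ^ n * A₀.det)|
      have hT0 : 0 ≤ T := Finset.sum_nonneg fun _ _ => abs_nonneg _
      have hMT : M A.scaledSchur.det ≤ T := by
        rw [hSdet]
        exact (le_abs_self _).trans (Finset.single_le_sum
          (f := fun a : ℤ => |M (a ^ n * A₀.det)|) (fun _ _ => abs_nonneg _)
          (Finset.mem_Icc.2 ⟨ha, haL⟩))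
      have hrow (j : Fin (n + 1)) : |B 0 j.succ| ≤ T + L ^ 2 := by
        have := hB0 j
        have := abs_nonneg (B 0 j.succ)
        linarith
      intro i j
      change |B i j| ≤ T + L ^ 2
      cases i using Fin.cases with
      | zero =>
        cases j using Fin.cases with
        | zero =>
          rw [hB00, abs_of_pos ha]
          linarith
        | succ j => exact hrow j
      | succ i =>
        cases j using Fin.cases with
        | zero =>
          rw [hBs.apply]
          exact hrow i
        | succ j =>
          have h1 : A 0 0 * |B i.succ j.succ| ≤ T + |B 0 i.succ| * |B 0 j.succ| := by
            calc A 0 0 * |B i.succ j.succ| = |A 0 0 * B i.succ j.succ| := by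
                  rw [abs_mul, abs_of_pos ha]
              _ ≤ |(Qᵀ * A.scaledSchur * Q) i j| + |B 0 i.succ * B 0 j.succ| := by
                  rw [hBS]
                  exact abs_add_le _ _
              _ ≤ T + |B 0 i.succ| * |B 0 j.succ| := by
                  rw [abs_mul]
                  linarith [hQM i j]
          have h2 : |B 0 i.succ| * |B 0 j.succ| ≤ L * L := by
            have h3 := hB0 i
            have h4 := hB0 j
            have h5 := abs_nonneg (B 0 i.succ)
            have h6 := abs_nonneg (B 0 j.succ)
            exact mul_le_mul (by linarith) (by linarith) h6 (by linarith)
          have h7 := abs_nonneg (B i.succ j.succ)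
          nlinarith

theorem Matrix.finite_setOf_abs_apply_le {ι : Type*} [Finite ι] (M : ℤ) :
    {B : Matrix ι ι ℤ | ∀ i j, |B i j| ≤ M}.Finite := by
  refine (Set.Finite.pi' fun _ : ι => Set.Finite.pi' fun _ : ι => Set.finite_Icc (-M) M).subset ?_
  exact fun B hB i j => abs_le.1 (hB i j)

theorem Matrix.PosDef.of_map_intCast {ι : Type*} [Fintype ι] {A : Matrix ι ι ℤ} (hA : A.IsSymm)
    (h : (A.map (fun x => (x : ℝ))).PosDef) : A.PosDef := by
  refine PosDef.of_dotProduct_mulVec_pos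
    (by rwa [IsHermitian, conjTranspose_eq_transpose_of_trivial]) fun x hx => ?_
  have hx' : (fun i => (x i : ℝ)) ≠ 0 := fun h0 => hx <| by
    ext i
    simpa using congrFun h0 i
  have := h.dotProduct_mulVec_pos hx'
  simp only [dotProduct, mulVec, star_trivial, map_apply] at this ⊢
  exact_mod_cast this

/-- Hermite's finiteness theorem: for fixed `n ≥ 1` and fixed positive determinant `D`,
there are only finitely many classes of symmetric positive definite `n × n` integer
matrices of determinant `D` up to integral congruence. -/
theorem hermite_finiteness_of_classes
    (n : ℕ) (hn : 1 ≤ n) (D : ℤ) (hD : 0 < D) :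
    ∃ S : Finset (Matrix (Fin n) (Fin n) ℤ),
      (∀ B ∈ S, B.IsSymm ∧ (B.map (fun x => (x : ℝ))).PosDef ∧ B.det = D) ∧
      ∀ A : Matrix (Fin n) (Fin n) ℤ, A.IsSymm →
        (A.map (fun x => (x : ℝ))).PosDef → A.det = D →
        ∃ P : Matrix (Fin n) (Fin n) ℤ, IsUnit P.det ∧ Pᵀ * A * P ∈ S := by
  obtain ⟨m, rfl⟩ := Nat.exists_eq_add_of_le' hn
  obtain ⟨K, -, M, hM⟩ := PosDef.exists_hermite_reduced m
  have hfin : {B : Matrix (Fin (m + 1)) (Fin (m + 1)) ℤ | (∀ i j, |B i j| ≤ M D) ∧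
      B.IsSymm ∧ (B.map (fun x => (x : ℝ))).PosDef ∧ B.det = D}.Finite :=
    (finite_setOf_abs_apply_le (M D)).subset fun B hB => hB.1
  refine ⟨hfin.toFinset, fun B hB => (hfin.mem_toFinset.1 hB).2, fun A hs hA hdet => ?_⟩
  obtain ⟨P, hP, -, hPM⟩ := hM A (.of_map_intCast hs hA) (hdet ▸ hD)
  refine ⟨P, hP, hfin.mem_toFinset.2
    ⟨hdet ▸ hPM, hs.congruence P, ?_, (det_congruence A hP).trans hdet⟩⟩
  have hPR : IsUnit (P.map (Int.castRingHom ℝ)) := by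
    rw [isUnit_iff_isUnit_det, ← RingHom.mapMatrix_apply, ← RingHom.map_det]
    exact hP.map _
  have h := hA.conjTranspose_mul_mul_same (mulVec_injective_of_isUnit hPR)
  rw [conjTranspose_eq_transpose_of_trivial] at h
  convert h using 1
  change (Pᵀ * A * P).map (Int.castRingHom ℝ) = _ * A.map (Int.castRingHom ℝ) * _
  rw [Matrix.map_mul, Matrix.map_mul, transpose_map]
end

section
/- Let 1 ≤ n ≤ 6 and let A be a symmetric positive definite n×n integer matrix with det A = 1. Then there exists P ∈ GL_n(ℤ) such that A = Pᵀ P; equivalently, A is integrally congruent to the identity matrix, so every positive definite integral form of determinant 1 in n ≤ 6 variables is equivalent to the sum of n squares. -/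
open Matrix

/-- The quadratic form `x ↦ xᵀ A x` of an integer matrix. -/
def intForm {n : ℕ} (A : Matrix (Fin n) (Fin n) ℤ) (x : Fin n → ℤ) : ℤ :=
  x ⬝ᵥ A *ᵥ x

/-- A symmetric integer matrix whose quadratic form is positive on nonzero integer vectors. -/
structure IsPosForm {n : ℕ} (A : Matrix (Fin n) (Fin n) ℤ) : Prop where
  symm : A.IsSymm
  pos : ∀ x, x ≠ 0 → 0 < intForm A x

/-- The upper left entry of `A` is minimal among those of all matrices congruent to `A`. -/
def IsCornerMinimal {n : ℕ} (A : Matrix (Fin (n + 1)) (Fin (n + 1)) ℤ) : Prop :=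
  ∀ P : Matrix (Fin (n + 1)) (Fin (n + 1)) ℤ, IsUnit P.det → A 0 0 ≤ (Pᵀ * A * P) 0 0

/-- The integral Schur complement of the upper left entry, scaled by that entry. -/
def cornerComplement {n : ℕ} (A : Matrix (Fin (n + 1)) (Fin (n + 1)) ℤ) :
    Matrix (Fin n) (Fin n) ℤ :=
  of fun i j => A 0 0 * A i.succ j.succ - A 0 i.succ * A 0 j.succ

/-- The block matrix with rows `(1, t)` and `(0, Q)`. -/
def bordered {n : ℕ} (t : Fin n → ℤ) (Q : Matrix (Fin n) (Fin n) ℤ) :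
    Matrix (Fin (n + 1)) (Fin (n + 1)) ℤ :=
  of (Fin.cons (Fin.cons 1 t) fun i => Fin.cons 0 (Q i))

theorem det_bordered {n : ℕ} (t : Fin n → ℤ) (Q : Matrix (Fin n) (Fin n) ℤ) :
    (bordered t Q).det = Q.det := by
  rw [det_succ_column_zero, Fin.sum_univ_succ]
  simp [bordered, submatrix]
  rfl

theorem intForm_congr {n : ℕ} (A P : Matrix (Fin n) (Fin n) ℤ) (x : Fin n → ℤ) :
    intForm (Pᵀ * A * P) x = intForm A (P *ᵥ x) := by
  simp only [intForm, ← mulVec_mulVec, dotProduct_mulVec x, vecMul_transpose]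

theorem apply_eq_intForm {n : ℕ} (A : Matrix (Fin n) (Fin n) ℤ) (i : Fin n) :
    A i i = intForm A (Pi.single i 1) := by
  simp [intForm]

theorem congr_apply {n : ℕ} (A P : Matrix (Fin n) (Fin n) ℤ) (i : Fin n) :
    (Pᵀ * A * P) i i = intForm A (P.col i) := by
  rw [apply_eq_intForm (Pᵀ * A * P), intForm_congr, mulVec_single_one]

theorem IsPosForm.congr {n : ℕ} {A P : Matrix (Fin n) (Fin n) ℤ} (hA : IsPosForm A)
    (hP : IsUnit P.det) : IsPosForm (Pᵀ * A * P) where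
  symm := by
    simp [IsSymm, transpose_mul, hA.symm.eq, Matrix.mul_assoc]
  pos x hx := by
    rw [intForm_congr]
    refine hA.pos _ fun h => hx ?_
    exact mulVec_injective_of_isUnit ((isUnit_iff_isUnit_det P).2 hP) (by simpa using h)

theorem det_congr_of_isUnit {n : ℕ} (A P : Matrix (Fin n) (Fin n) ℤ) (hP : IsUnit P.det) :
    (Pᵀ * A * P).det = A.det := by
  rw [det_mul, det_mul, det_transpose, mul_right_comm, Int.isUnit_mul_self hP, one_mul]

theorem IsPosForm.corner_pos {n : ℕ} {A : Matrix (Fin (n + 1)) (Fin (n + 1)) ℤ}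
    (hA : IsPosForm A) : 0 < A 0 0 := by
  rw [apply_eq_intForm A]
  exact hA.pos _ (by simp)

theorem intForm_cornerComplement {n : ℕ} {A : Matrix (Fin (n + 1)) (Fin (n + 1)) ℤ}
    (hA : A.IsSymm) (t : ℤ) (x : Fin n → ℤ) :
    intForm (cornerComplement A) x =
      A 0 0 * intForm A (Fin.cons t x) - (A 0 0 * t + ∑ i, A 0 i.succ * x i) ^ 2 := by
  have h0 : ∀ i : Fin n, A i.succ 0 = A 0 i.succ := fun i => hA.apply _ _
  have h1 : intForm (cornerComplement A) x =
      A 0 0 * (∑ i, x i * ∑ j, A i.succ j.succ * x j) - (∑ i, A 0 i.succ * x i) ^ 2 := by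
    simp only [intForm, cornerComplement, dotProduct, mulVec, of_apply, sub_mul, mul_sub,
      Finset.sum_sub_distrib, sq, Finset.mul_sum, Finset.sum_mul]
    congr 1 <;> exact Finset.sum_congr rfl fun i _ => Finset.sum_congr rfl fun j _ => by ring
  have h2 : intForm A (Fin.cons t x) = A 0 0 * t ^ 2 + 2 * t * (∑ i, A 0 i.succ * x i) +
      ∑ i, x i * ∑ j, A i.succ j.succ * x j := by
    simp only [intForm, dotProduct, mulVec, Fin.sum_univ_succ, Fin.cons_zero, Fin.cons_succ, h0,
      mul_add, Finset.sum_add_distrib]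
    have : ∑ i, x i * (A 0 i.succ * t) = t * ∑ i, A 0 i.succ * x i := by
      rw [Finset.mul_sum]
      exact Finset.sum_congr rfl fun i _ => by ring
    rw [this]
    ring
  rw [h1, h2]
  ring

theorem IsPosForm.cornerComplement {n : ℕ} {A : Matrix (Fin (n + 1)) (Fin (n + 1)) ℤ}
    (hA : IsPosForm A) : IsPosForm (cornerComplement A) where
  symm := by
    ext i j
    simp only [_root_.cornerComplement, transpose_apply, of_apply, hA.symm.apply i.succ j.succ]
    ring
  pos x hx := by
    have ha := hA.corner_pos
    have hne : (Fin.cons (-∑ i, A 0 i.succ * x i) (A 0 0 • x) : Fin (n + 1) → ℤ) ≠ 0 := by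
      intro h
      apply hx
      ext i
      have := congrFun h i.succ
      simpa [ha.ne'] using this
    have hpos := hA.pos _ hne
    have h := intForm_cornerComplement hA.symm (-∑ i, A 0 i.succ * x i) (A 0 0 • x)
    have hs : ∑ i, A 0 i.succ * (A 0 0 • x) i = A 0 0 * ∑ i, A 0 i.succ * x i := by
      rw [Finset.mul_sum]
      exact Finset.sum_congr rfl fun i _ => by simp; ring
    have hsmul : intForm (_root_.cornerComplement A) (A 0 0 • x) =
        A 0 0 ^ 2 * intForm (_root_.cornerComplement A) x := by
      simp only [intForm, mulVec_smul, smul_dotProduct, dotProduct_smul, smul_eq_mul]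
      ring
    rw [hs, hsmul] at h
    have h' : A 0 0 ^ 2 * intForm (_root_.cornerComplement A) x =
        A 0 0 * intForm A (Fin.cons (-∑ i, A 0 i.succ * x i) (A 0 0 • x)) := by
      rw [h]
      ring
    exact pos_of_mul_pos_right (h' ▸ mul_pos ha hpos) (sq_nonneg _)

theorem corner_mul_det_cornerComplement {n : ℕ} (A : Matrix (Fin (n + 1)) (Fin (n + 1)) ℤ)
    (hA : A.IsSymm) : A 0 0 * (cornerComplement A).det = A 0 0 ^ n * A.det := by
  have hprod : A * bordered (fun i => -A 0 i.succ) (diagonal fun _ => A 0 0) =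
      of (Fin.cons (Fin.cons (A 0 0) 0)
        fun i => Fin.cons (A i.succ 0) (cornerComplement A i)) := by
    ext i j
    refine Fin.cases ?_ (fun i => ?_) i <;> refine Fin.cases ?_ (fun j => ?_) j <;>
      simp [Matrix.mul_apply, Fin.sum_univ_succ, bordered, cornerComplement, diagonal_apply,
        hA.apply]
    all_goals ring
  have hdet := congrArg det hprod
  rw [det_mul, det_bordered, det_diagonal, det_succ_row_zero (of _), Fin.sum_univ_succ] at hdet
  simp [submatrix] at hdet
  rw [mul_comm (A 0 0 ^ n), hdet]
  rfl

theorem det_cornerComplement {n : ℕ} {A : Matrix (Fin (n + 2)) (Fin (n + 2)) ℤ}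
    (hA : IsPosForm A) : (cornerComplement A).det = A 0 0 ^ n * A.det := by
  have h := corner_mul_det_cornerComplement A hA.symm
  rw [pow_succ', mul_assoc] at h
  exact mul_left_cancel₀ hA.corner_pos.ne' h

theorem IsPosForm.exists_isCornerMinimal {n : ℕ} {A : Matrix (Fin (n + 1)) (Fin (n + 1)) ℤ}
    (hA : IsPosForm A) :
    ∃ P : Matrix (Fin (n + 1)) (Fin (n + 1)) ℤ, IsUnit P.det ∧ IsCornerMinimal (Pᵀ * A * P) := by
  obtain ⟨P, hP, hmin⟩ := (measure fun P : Matrix (Fin (n + 1)) (Fin (n + 1)) ℤ =>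
    ((Pᵀ * A * P) 0 0).toNat).wf.has_min {P | IsUnit P.det} ⟨1, by simp⟩
  refine ⟨P, hP, fun Q hQ => ?_⟩
  have hPQ : IsUnit (P * Q).det := by
    rw [det_mul]
    exact hP.mul hQ
  have hle : ¬ (((P * Q)ᵀ * A * (P * Q)) 0 0).toNat < ((Pᵀ * A * P) 0 0).toNat :=
    hmin (P * Q) hPQ
  have hpos := (hA.congr hPQ).corner_pos
  have heq : Qᵀ * (Pᵀ * A * P) * Q = (P * Q)ᵀ * A * (P * Q) := by
    simp only [transpose_mul, Matrix.mul_assoc]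
  rw [heq]
  omega

/-- Every value of the complement on a primitive vector comes from a binary section of a
corner-minimal form which is reduced in the sense of Lagrange. -/
theorem IsCornerMinimal.exists_reduced {n : ℕ} {A : Matrix (Fin (n + 2)) (Fin (n + 2)) ℤ}
    (hmin : IsCornerMinimal A) (hA : IsPosForm A) {Q : Matrix (Fin (n + 1)) (Fin (n + 1)) ℤ}
    (hQ : IsUnit Q.det) :
    ∃ b c : ℤ, A 0 0 ≤ c ∧ 2 * |b| ≤ A 0 0 ∧
      (Qᵀ * cornerComplement A * Q) 0 0 = A 0 0 * c - b ^ 2 := by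
  have ha := hA.corner_pos
  set s := ∑ i, A 0 i.succ * Q.col 0 i
  obtain ⟨t, ht⟩ : ∃ t : ℤ, 2 * |A 0 0 * t + s| ≤ A 0 0 := by
    refine ⟨-((2 * s + A 0 0) / (2 * A 0 0)), ?_⟩
    have h1 := Int.mul_ediv_add_emod (2 * s + A 0 0) (2 * A 0 0)
    have h2 := Int.emod_nonneg (2 * s + A 0 0) (by omega : 2 * A 0 0 ≠ 0)
    have h3 := Int.emod_lt_of_pos (2 * s + A 0 0) (by omega : 0 < 2 * A 0 0)
    have : |2 * (A 0 0 * -((2 * s + A 0 0) / (2 * A 0 0)) + s)| ≤ A 0 0 := by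
      rw [abs_le]
      constructor <;> linarith
    rwa [abs_mul, abs_two] at this
  refine ⟨A 0 0 * t + s, intForm A (Fin.cons t (Q.col 0)), ?_, ht, ?_⟩
  · let P := (bordered (fun _ => t) Q).submatrix id (Equiv.swap 0 1)
    have hP : IsUnit P.det := by
      simp only [P, det_permute', det_bordered]
      exact IsUnit.mul (by simp) hQ
    have hcol : P.col 0 = Fin.cons t (Q.col 0) := by
      ext i
      refine Fin.cases ?_ (fun i => ?_) i <;>
        simp [P, bordered, Matrix.col, ← Fin.succ_zero_eq_one, -Fin.succ_zero_eq_one']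
    have := hmin P hP
    rwa [congr_apply, hcol] at this
  · rw [congr_apply, intForm_cornerComplement hA.symm t]

theorem IsCornerMinimal.hermite {n : ℕ} {A : Matrix (Fin (n + 1)) (Fin (n + 1)) ℤ}
    (hmin : IsCornerMinimal A) (hA : IsPosForm A) :
    3 ^ (n + 1).choose 2 * A 0 0 ^ (n + 1) ≤ 4 ^ (n + 1).choose 2 * A.det := by
  induction n with
  | zero => simp
  | succ n ih =>
    have ha := hA.corner_pos
    obtain ⟨Q, hQ, hQmin⟩ := hA.cornerComplement.exists_isCornerMinimal
    obtain ⟨b, c, hc, hb, hbc⟩ := hmin.exists_reduced hA hQ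
    have hpos := hA.cornerComplement.congr hQ
    have h := ih hQmin hpos
    rw [det_congr_of_isUnit _ _ hQ, det_cornerComplement hA] at h
    set β := (Qᵀ * cornerComplement A * Q) 0 0
    have hβ : 3 * A 0 0 ^ 2 ≤ 4 * β := by
      have := sq_le_sq' (by linarith [abs_nonneg b]) hb
      rw [mul_pow, sq_abs] at this
      nlinarith
    have hpow : (3 * A 0 0 ^ 2) ^ (n + 1) ≤ (4 * β) ^ (n + 1) := by gcongr
    have hch : (n + 1 + 1).choose 2 = (n + 1).choose 2 + (n + 1) := by
      rw [Nat.choose_succ_succ' (n + 1) 1, Nat.choose_one_right, add_comm]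
    rw [hch]
    refine le_of_mul_le_mul_left ?_ (pow_pos ha n)
    calc A 0 0 ^ n * (3 ^ ((n + 1).choose 2 + (n + 1)) * A 0 0 ^ (n + 1 + 1))
        = 3 ^ (n + 1).choose 2 * (3 * A 0 0 ^ 2) ^ (n + 1) := by
          rw [mul_pow]; ring
      _ ≤ 3 ^ (n + 1).choose 2 * (4 * β) ^ (n + 1) := by gcongr
      _ = 4 ^ (n + 1) * (3 ^ (n + 1).choose 2 * β ^ (n + 1)) := by ring
      _ ≤ 4 ^ (n + 1) * (4 ^ (n + 1).choose 2 * (A 0 0 ^ n * A.det)) := by gcongr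
      _ = A 0 0 ^ n * (4 ^ ((n + 1).choose 2 + (n + 1)) * A.det) := by ring

/-- In dimension six, Hermite's bound does not exclude the minimum `2`; descending through two
successive complements does. -/
theorem IsCornerMinimal.corner_ne_two {A : Matrix (Fin 6) (Fin 6) ℤ}
    (hmin : IsCornerMinimal A) (hA : IsPosForm A) (hdet : A.det = 1) : A 0 0 ≠ 2 := by
  intro h2
  obtain ⟨Q, hQ, hBmin⟩ := hA.cornerComplement.exists_isCornerMinimal
  obtain ⟨b, c, hc, hb, hbc⟩ := hmin.exists_reduced hA hQ
  have hB := hA.cornerComplement.congr hQ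
  have hBdet : (Qᵀ * cornerComplement A * Q).det = 16 := by
    rw [det_congr_of_isUnit _ _ hQ, det_cornerComplement hA, h2, hdet]
    norm_num
  generalize Qᵀ * cornerComplement A * Q = B at *
  have hB3 : B 0 0 = 3 := by
    have hle := hBmin.hermite hB
    rw [hBdet, Nat.choose_two_right] at hle
    have h3 : 3 ≤ B 0 0 := by
      rw [h2] at hbc hc hb
      have : b ^ 2 ≤ 1 := (sq_le_one_iff_abs_le_one b).2 (by linarith)
      linarith
    by_contra hne
    have h4 : 4 ≤ B 0 0 := by omega
    have : (4 : ℤ) ^ 5 ≤ B 0 0 ^ 5 := by gcongr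
    norm_num at hle
    omega
  obtain ⟨R, hR, hCmin⟩ := hB.cornerComplement.exists_isCornerMinimal
  obtain ⟨d, e, he, hd, hde⟩ := hBmin.exists_reduced hB hR
  have hle := hCmin.hermite (hB.cornerComplement.congr hR)
  rw [det_congr_of_isUnit _ _ hR, det_cornerComplement hB, hB3, hBdet, hde, hB3,
    Nat.choose_two_right] at hle
  rw [hB3] at he hd
  have hd1 : d ^ 2 ≤ 1 := (sq_le_one_iff_abs_le_one d).2 (by omega)
  have h8 : (8 : ℤ) ≤ 3 * e - d ^ 2 := by linarith
  have : (8 : ℤ) ^ 4 ≤ (3 * e - d ^ 2) ^ 4 := by gcongr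
  norm_num at hle
  omega

theorem IsCornerMinimal.corner_eq_one {n : ℕ} (hn : n ≤ 5)
    {A : Matrix (Fin (n + 1)) (Fin (n + 1)) ℤ}
    (hmin : IsCornerMinimal A) (hA : IsPosForm A) (hdet : A.det = 1) : A 0 0 = 1 := by
  have ha := hA.corner_pos
  have h := hmin.hermite hA
  rw [hdet, Nat.choose_two_right] at h
  by_contra hne
  rcases hn.lt_or_eq with hn | rfl
  · have h2 : 2 ≤ A 0 0 := by omega
    have : (2 : ℤ) ^ (n + 1) ≤ A 0 0 ^ (n + 1) := by gcongr
    interval_cases n <;> norm_num at h this <;> omega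
  · have := hmin.corner_ne_two hA hdet
    have h3 : 3 ≤ A 0 0 := by omega
    have : (3 : ℤ) ^ 6 ≤ A 0 0 ^ 6 := by gcongr
    norm_num at h
    omega

theorem eq_bordered_transpose_mul {n : ℕ} {A : Matrix (Fin (n + 1)) (Fin (n + 1)) ℤ}
    (hA : A.IsSymm) (h1 : A 0 0 = 1) {Q : Matrix (Fin n) (Fin n) ℤ}
    (hQ : cornerComplement A = Qᵀ * Q) :
    A = (bordered (fun i => A 0 i.succ) Q)ᵀ * bordered (fun i => A 0 i.succ) Q := by
  ext i j
  refine Fin.cases ?_ (fun i => ?_) i <;> refine Fin.cases ?_ (fun j => ?_) j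
  · simp [Matrix.mul_apply, Fin.sum_univ_succ, bordered, h1]
  · simp [Matrix.mul_apply, Fin.sum_univ_succ, bordered]
  · simp [Matrix.mul_apply, Fin.sum_univ_succ, bordered, hA.apply]
  · have h := congrFun (congrFun hQ i) j
    simp only [cornerComplement, of_apply, h1, one_mul, Matrix.mul_apply, transpose_apply] at h
    simp [Matrix.mul_apply, Fin.sum_univ_succ, bordered, ← h]

theorem IsPosForm.exists_eq_transpose_mul {n : ℕ} (hn : n ≤ 6) {A : Matrix (Fin n) (Fin n) ℤ}
    (hA : IsPosForm A) (hdet : A.det = 1) : ∃ P : Matrix (Fin n) (Fin n) ℤ, A = Pᵀ * P := by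
  induction n with
  | zero => exact ⟨1, Subsingleton.elim _ _⟩
  | succ n ih =>
    obtain ⟨P, hP, hmin⟩ := hA.exists_isCornerMinimal
    have hA' := hA.congr hP
    have hdet' := (det_congr_of_isUnit A P hP).trans hdet
    have h1 := hmin.corner_eq_one (by omega) hA' hdet'
    have hdetc := corner_mul_det_cornerComplement _ hA'.symm
    rw [h1, hdet', one_pow, one_mul, one_mul] at hdetc
    obtain ⟨Q, hQ⟩ := ih (by omega) hA'.cornerComplement hdetc
    have hR := eq_bordered_transpose_mul hA'.symm h1 hQ
    set R := bordered (fun i => (Pᵀ * A * P) 0 i.succ) Q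
    refine ⟨R * P⁻¹, ?_⟩
    have hPP : P * P⁻¹ = 1 := mul_nonsing_inv P hP
    calc A = (P * P⁻¹)ᵀ * A * (P * P⁻¹) := by simp [hPP]
      _ = (P⁻¹)ᵀ * (Pᵀ * A * P) * P⁻¹ := by simp only [transpose_mul, Matrix.mul_assoc]
      _ = (P⁻¹)ᵀ * (Rᵀ * R) * P⁻¹ := by rw [hR]
      _ = (R * P⁻¹)ᵀ * (R * P⁻¹) := by simp only [transpose_mul, Matrix.mul_assoc]

/-- Hermite's uniqueness result: for `1 ≤ n ≤ 6`, every symmetric positive definite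
`n × n` integer matrix of determinant `1` is integrally congruent to the identity,
i.e. `A = Pᵀ P` for some `P ∈ GL_n(ℤ)`; every positive definite integral form of
determinant 1 in at most 6 variables is equivalent to the sum of `n` squares. -/
theorem posdef_det_one_is_sum_of_squares_of_dim_le_six
    (n : ℕ) (hn1 : 1 ≤ n) (hn6 : n ≤ 6)
    (A : Matrix (Fin n) (Fin n) ℤ) (hsymm : A.IsSymm)
    (hpd : (A.map (fun x => (x : ℝ))).PosDef) (hdet : A.det = 1) :
    ∃ P : Matrix (Fin n) (Fin n) ℤ, IsUnit P.det ∧ A = Pᵀ * P := by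
  have hA : IsPosForm A := by
    refine ⟨hsymm, fun x hx => ?_⟩
    have hx' : (fun i => (x i : ℝ)) ≠ 0 := fun h => hx <| by
      ext i
      simpa using congrFun h i
    have h := hpd.dotProduct_mulVec_pos hx'
    have hcast : star (fun i => (x i : ℝ)) ⬝ᵥ A.map (fun x => (x : ℝ)) *ᵥ (fun i => (x i : ℝ)) =
        (intForm A x : ℝ) := by
      simp [intForm, dotProduct, mulVec]
    rw [hcast] at h
    exact_mod_cast h
  obtain ⟨P, hP⟩ := hA.exists_eq_transpose_mul hn6 hdet
  refine ⟨P, ?_, hP⟩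
  rw [hP, det_mul, det_transpose] at hdet
  exact IsUnit.of_mul_eq_one _ hdet
end

section
/- Let p be a prime number with p ≡ 1 (mod 5), let K = ℚ(ζ) be the fifth cyclotomic field with ζ a primitive 5th root of unity. Then there exist integers a, b, c, d such that p = N_{K/ℚ}(a + bζ + cζ² + dζ³), i.e. p equals the product of the four Galois conjugates of a + bζ + cζ² + dζ³; in particular p is a product of four linear combinations with integral coefficients of powers of a fifth root of unity. -/
open NumberField Polynomial

/-- The norm of an element of a totally complex number field is nonnegative. -/
theorem NumberField.IsTotallyComplex.norm_nonneg {K : Type*} [Field K] [NumberField K]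
    [IsTotallyComplex K] (x : K) : 0 ≤ Algebra.norm ℚ x := by
  classical
  have key : ((Algebra.norm ℚ x : ℚ) : ℂ) = ((∏ w : InfinitePlace K, w x ^ 2 : ℝ) : ℂ) := by
    rw [← eq_ratCast (algebraMap ℚ ℂ), Algebra.norm_eq_prod_embeddings ℚ ℂ x,
      ← Fintype.prod_equiv (RingHom.equivRatAlgHom K ℂ) (fun φ => φ x) (fun φ => φ x)
        fun _ => by simp [RingHom.equivRatAlgHom_apply],
      ← Finset.prod_fiberwise Finset.univ InfinitePlace.mk (fun φ => φ x), Complex.ofReal_prod]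
    refine Finset.prod_congr rfl fun w _ => ?_
    have hne : w.embedding ≠ ComplexEmbedding.conjugate w.embedding := fun h =>
      InfinitePlace.isComplex_iff.mp (IsTotallyComplex.isComplex w)
        (ComplexEmbedding.isReal_iff.mpr h.symm)
    have hfiber : ({φ | InfinitePlace.mk φ = w} : Finset (K →+* ℂ)) =
        {w.embedding, ComplexEmbedding.conjugate w.embedding} := by
      ext φ
      rw [Finset.mem_filter, Finset.mem_insert, Finset.mem_singleton]
      conv_lhs => rw [← InfinitePlace.mk_embedding w, eq_comm, InfinitePlace.mk_eq_iff]
      simp [eq_comm]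
    rw [hfiber, Finset.prod_pair hne, ComplexEmbedding.conjugate_coe_eq, Complex.mul_conj,
      Complex.normSq_eq_norm_sq, InfinitePlace.norm_embedding_eq]
  have key' : ((Algebra.norm ℚ x : ℚ) : ℝ) = ∏ w : InfinitePlace K, w x ^ 2 := by
    exact_mod_cast key
  have : (0 : ℝ) ≤ (Algebra.norm ℚ x : ℚ) := by rw [key']; positivity
  exact_mod_cast this

/-- If the ring of integers of the `n`-th cyclotomic field is principal and `2 < n`, then every
prime `p ≡ 1 (mod n)` is the norm of an algebraic integer. -/
theorem IsCyclotomicExtension.Rat.exists_norm_eq_of_prime {n p : ℕ} [NeZero n] (hn : 2 < n)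
    (hp : p.Prime) (hmod : (p : ZMod n) = 1) (K : Type*) [Field K] [NumberField K]
    [IsCyclotomicExtension {n} ℚ K] [IsPrincipalIdealRing (𝓞 K)] :
    ∃ x : 𝓞 K, Algebra.norm ℚ (x : K) = p := by
  have : Fact p.Prime := ⟨hp⟩
  have : IsTotallyComplex K := IsCyclotomicExtension.Rat.isTotallyComplex K hn
  have hdvd : ¬ p ∣ n := fun h => by
    have hunit : IsUnit (p : ZMod n) := by simp [hmod]
    exact hp.one_lt.ne' (((ZMod.isUnit_iff_coprime p n).mp hunit).eq_one_of_dvd h)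
  have hmax : (Ideal.span {(p : ℤ)}).IsMaximal :=
    Int.ideal_span_isMaximal_of_prime p
  obtain ⟨P, _, _⟩ :=
    Ideal.exists_maximal_ideal_liesOver_of_isIntegral (S := 𝓞 K) (Ideal.span {(p : ℤ)})
  obtain ⟨x, rfl⟩ := IsPrincipalIdealRing.principal P
  have habs := Ideal.absNorm_pow_inertiaDeg (Ideal.span {(p : ℤ)}) (Ideal.span {x})
  rw [IsCyclotomicExtension.Rat.inertiaDeg_eq_of_not_dvd p K _ hdvd, hmod, orderOf_one, pow_one,
    Ideal.absNorm_span_singleton, Ideal.absNorm_span_singleton, Algebra.norm_self,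
    MonoidHom.id_apply, Int.natAbs_natCast] at habs
  refine ⟨x, ?_⟩
  have hnonneg := IsTotallyComplex.norm_nonneg (x : K)
  rw [← Algebra.coe_norm_int] at hnonneg ⊢
  have hnonneg' : 0 ≤ Algebra.norm ℤ x := by exact_mod_cast hnonneg
  have : Algebra.norm ℤ x = p := by omega
  exact_mod_cast this

/-- Every algebraic integer of the `n`-th cyclotomic field is an integral linear combination of
`1, ζ, …, ζ ^ (φ n - 1)`. -/
theorem IsPrimitiveRoot.exists_eq_sum_range_totient {n : ℕ} [NeZero n] {K : Type*} [Field K]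
    [NumberField K] [IsCyclotomicExtension {n} ℚ K] {ζ : K} (hζ : IsPrimitiveRoot ζ n) (x : 𝓞 K) :
    ∃ f : ℕ → ℤ, (x : K) = ∑ i ∈ Finset.range n.totient, (f i : K) * ζ ^ i := by
  obtain ⟨f, hf, rfl⟩ := hζ.integralPowerBasis.exists_eq_aeval x
  rw [hζ.integralPowerBasis_dim] at hf
  refine ⟨f.coeff, ?_⟩
  rw [Polynomial.aeval_eq_sum_range' hf, hζ.integralPowerBasis_gen]
  simp [show algebraMap (𝓞 K) K hζ.toInteger = ζ from rfl]

/-- Jacobi's statement, proved by Hermite: every prime `p ≡ 1 (mod 5)` is the norm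
from the fifth cyclotomic field `K = ℚ(ζ)` of an integral linear combination
`a + b ζ + c ζ² + d ζ³` of powers of a primitive fifth root of unity `ζ`;
i.e. `p` is the product of the four Galois conjugates of such an element. -/
theorem prime_one_mod_five_is_norm_from_fifth_cyclotomic_field
    (p : ℕ) (hp : p.Prime) (hmod : p % 5 = 1)
    (ζ : CyclotomicField 5 ℚ) (hζ : IsPrimitiveRoot ζ 5) :
    ∃ a b c d : ℤ,
      (p : ℚ) = Algebra.norm ℚ
        ((a : CyclotomicField 5 ℚ) + (b : CyclotomicField 5 ℚ) * ζ
          + (c : CyclotomicField 5 ℚ) * ζ ^ 2 + (d : CyclotomicField 5 ℚ) * ζ ^ 3) := by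
  have : IsCyclotomicExtension {5} ℚ (CyclotomicField 5 ℚ) :=
    CyclotomicField.isCyclotomicExtension 5 ℚ
  have := IsCyclotomicExtension.Rat.five_pid (CyclotomicField 5 ℚ)
  have hmod' : (p : ZMod 5) = 1 := by
    rw [← ZMod.natCast_mod, hmod, Nat.cast_one]
  obtain ⟨x, hx⟩ := IsCyclotomicExtension.Rat.exists_norm_eq_of_prime (n := 5) (by norm_num) hp
    hmod' (CyclotomicField 5 ℚ)
  obtain ⟨f, hf⟩ := hζ.exists_eq_sum_range_totient x
  refine ⟨f 0, f 1, f 2, f 3, ?_⟩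
  rw [← hx, hf, Nat.totient_prime Nat.prime_five]
  simp [Finset.sum_range_succ]
end
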